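/- Let G be a group with automatic structures L₁ ⊆ A* for π₁ : A* → G and L₂ ⊆ B* for π₂ : B* → G, and let ι denote the identity endomorphism of G. Then L₁ and L₂ are equivalent if and only if the BRP holds for (ι, L₁, L₂); and L₁ and L₂ are synchronously equivalent if and only if the synchronous BRP holds for (ι, L₁, L₂). -/

import Mathlib

open scoped NNReal

namespace Auto

/-- The generating set `Aπ ∪ (Aπ)⁻¹` of `G` determined by `π : A* → G`. -/
def gens {A G : Type*} [Group G] (π : FreeMonoid A →* G) : Set G :=
  (Set.range fun a : A => π (FreeMonoid.of a)) ∪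
    Set.range fun a : A => (π (FreeMonoid.of a))⁻¹

/-- The word metric `d_A` on `G`: the least `n` such that `g⁻¹h` is a product of `n`
elements of `Aπ ∪ (Aπ)⁻¹`. -/
noncomputable def wdist {A G : Type*} [Group G] (π : FreeMonoid A →* G) (g h : G) : ℕ :=
  sInf {n : ℕ | ∃ l : List G, l.length = n ∧ (∀ x ∈ l, x ∈ gens π) ∧ l.prod = g⁻¹ * h}

/-- Evaluation of a word of `A*` in `G`. -/
def evalW {A G : Type*} [Group G] (π : FreeMonoid A →* G) (w : List A) : G :=
  π (FreeMonoid.ofList w)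

/-- `u` and `v` `p`-fellow travel: `d_A(u^[n]π, v^[n]π) ≤ p` for all `n`. -/
def FellowTravel {A G : Type*} [Group G] (π : FreeMonoid A →* G) (p : ℝ≥0)
    (u v : List A) : Prop :=
  ∀ n : ℕ, (wdist π (evalW π (u.take n)) (evalW π (v.take n)) : ℝ≥0) ≤ p

/-- `u` and `v` are `p`-meeting-fellow-travellers. -/
def MFT {A G : Type*} [Group G] (π : FreeMonoid A →* G) (p : ℝ≥0) (u v : List A) : Prop :=
  FellowTravel π p u v ∧ evalW π u = evalW π v

/-- A language is regular if it is accepted by a finite-state automaton. -/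
def IsRegular {A : Type*} (L : Language A) : Prop :=
  ∃ (σ : Type) (_ : Fintype σ) (M : DFA A σ), M.accepts = L

/-- `L` is an automatic structure for `π`. -/
structure IsAutomaticStructure {A G : Type*} [Group G] (π : FreeMonoid A →* G)
    (L : Language A) : Prop where
  regular : IsRegular L
  onto : ∀ g : G, ∃ w ∈ L, evalW π w = g
  ft : ∃ N : ℕ, ∀ u ∈ L, ∀ v ∈ L,
    wdist π (evalW π u) (evalW π v) ≤ 1 → FellowTravel π N u v

/-- Evaluation of an element of `A ∪ {ε}`. -/
def evalOpt {A G : Type*} [Group G] (π : FreeMonoid A →* G) : Option A → G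
  | none => 1
  | some a => π (FreeMonoid.of a)

/-- `L` is a biautomatic structure for `π`. -/
structure IsBiautomaticStructure {A G : Type*} [Group G] (π : FreeMonoid A →* G)
    (L : Language A) extends IsAutomaticStructure π L : Prop where
  bi : ∃ N : ℕ, ∀ u ∈ L, ∀ v ∈ L, ∀ a : Option A,
    evalW π v = evalOpt π a * evalW π u →
    ∀ n : ℕ, wdist π (evalOpt π a * evalW π (u.take n)) (evalW π (v.take n)) ≤ N

/-- A language is factorial if it is closed under taking factors. -/
def IsFactorial {A : Type*} (L : Language A) : Prop :=
  ∀ u ∈ L, ∀ v : List A, v <:+: u → v ∈ L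

/-- `D : ℝ≥0 → ℝ≥0` is a departure function for `(G, L)`. -/
def IsDepartureFunction {A G : Type*} [Group G] (π : FreeMonoid A →* G) (L : Language A)
    (D : ℝ≥0 → ℝ≥0) : Prop :=
  ∀ w ∈ L, ∀ r : ℝ≥0, ∀ s t : ℕ, D r ≤ (t : ℝ≥0) → s + t ≤ w.length →
    r < (wdist π (evalW π (w.take s)) (evalW π (w.take (s + t))) : ℝ≥0)

/-- Every point of `S` is within distance `N` of `T`. -/
def NbhdIn {A G : Type*} [Group G] (π : FreeMonoid A →* G) (N : ℕ) (S T : Set G) : Prop :=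
  ∀ s ∈ S, ∃ t ∈ T, wdist π s t ≤ N

/-- The Hausdorff distance between `S` and `T` is at most `N`. -/
def HausdorffLE {A G : Type*} [Group G] (π : FreeMonoid A →* G) (N : ℕ)
    (S T : Set G) : Prop :=
  NbhdIn π N S T ∧ NbhdIn π N T S

/-- `H` is an `L`-quasiconvex subgroup of `G`. -/
def IsQuasiconvex {A G : Type*} [Group G] (π : FreeMonoid A →* G) (L : Language A)
    (H : Subgroup G) : Prop :=
  ∃ k : ℕ, ∀ h ∈ H, ∀ h' ∈ H, ∀ w ∈ L, h * evalW π w = h' →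
    ∀ n : ℕ, ∃ z ∈ H, wdist π (h * evalW π (w.take n)) z ≤ k

/-- The bounded reduction property for `(φ, L, L')`. -/
def BRP {A B G G' : Type*} [Group G] [Group G'] (π : FreeMonoid A →* G)
    (π' : FreeMonoid B →* G') (φ : G →* G') (L : Language A) (L' : Language B) : Prop :=
  ∃ N : ℕ, ∀ x : G, ∀ α ∈ L, ∀ β ∈ L', evalW π' β = φ (evalW π α) →
    HausdorffLE π' N (Set.range fun n : ℕ => φ (x * evalW π (α.take n)))
      (Set.range fun n : ℕ => φ x * evalW π' (β.take n))

/-- The synchronous bounded reduction property for `(φ, L, L')`. -/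
def SyncBRP {A B G G' : Type*} [Group G] [Group G'] (π : FreeMonoid A →* G)
    (π' : FreeMonoid B →* G') (φ : G →* G') (L : Language A) (L' : Language B) : Prop :=
  ∃ N : ℕ, ∀ x : G, ∀ α ∈ L, ∀ β ∈ L', evalW π' β = φ (evalW π α) →
    ∀ n : ℕ, wdist π' (φ (x * evalW π (α.take n))) (φ x * evalW π' (β.take n)) ≤ N

/-- The fellow traveller bounded reduction property (FT-BRP) for `(φ, L, L')`. -/
def FTBRP {A B G G' : Type*} [Group G] [Group G'] (π : FreeMonoid A →* G)
    (π' : FreeMonoid B →* G') (φ : G →* G') (L : Language A) (L' : Language B) : Prop :=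
  ∀ p : ℝ≥0, ∃ q : ℝ≥0,
    ∀ u₁ ∈ L, ∀ u₂ ∈ L, ∀ u₃ ∈ L, ∀ u₁' ∈ L', ∀ u₂' ∈ L', ∀ u₃' ∈ L',
      evalW π' u₁' = φ (evalW π u₁) → evalW π' u₂' = φ (evalW π u₂) →
        evalW π' u₃' = φ (evalW π u₃) →
          MFT π p (u₁ ++ u₂) u₃ → MFT π' q (u₁' ++ u₂') u₃'

/-- The natural homomorphism `(A ⊔ B)* → G` agreeing with `π₁` on `A` and `π₂` on `B`. -/
def sumHom {A B G : Type*} [Group G] (π₁ : FreeMonoid A →* G) (π₂ : FreeMonoid B →* G) :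
    FreeMonoid (A ⊕ B) →* G :=
  FreeMonoid.lift (Sum.elim (fun a => π₁ (FreeMonoid.of a)) fun b => π₂ (FreeMonoid.of b))

/-- The union `L₁ ∪ L₂` viewed as a language over `A ⊔ B`. -/
def unionLang {A B : Type*} (L₁ : Language A) (L₂ : Language B) : Language (A ⊕ B) :=
  {w : List (A ⊕ B) | (∃ u ∈ L₁, w = u.map Sum.inl) ∨ ∃ v ∈ L₂, w = v.map Sum.inr}

/-- `L` is an asynchronous automatic structure for `π`. -/
def IsAsyncAutomaticStructure {A G : Type*} [Group G] (π : FreeMonoid A →* G)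
    (L : Language A) : Prop :=
  IsRegular L ∧ (∀ g : G, ∃ w ∈ L, evalW π w = g) ∧
    ∃ p : ℕ, ∀ u ∈ L, ∀ v ∈ L, wdist π (evalW π u) (evalW π v) ≤ 1 →
      ∃ φ ψ : ℕ → ℕ, Monotone φ ∧ Monotone ψ ∧
        Function.Surjective φ ∧ Function.Surjective ψ ∧
          ∀ t : ℕ, wdist π (evalW π (u.take (φ t))) (evalW π (v.take (ψ t))) ≤ p

/-- `L₁` and `L₂` are equivalent automatic structures. -/
def LangEquivalent {A B G : Type*} [Group G] (π₁ : FreeMonoid A →* G)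
    (π₂ : FreeMonoid B →* G) (L₁ : Language A) (L₂ : Language B) : Prop :=
  IsAsyncAutomaticStructure (sumHom π₁ π₂) (unionLang L₁ L₂)

/-- `L₁` and `L₂` are synchronously equivalent automatic structures. -/
def LangSyncEquivalent {A B G : Type*} [Group G] (π₁ : FreeMonoid A →* G)
    (π₂ : FreeMonoid B →* G) (L₁ : Language A) (L₂ : Language B) : Prop :=
  IsAutomaticStructure (sumHom π₁ π₂) (unionLang L₁ L₂)

/-- `L` has the Hausdorff closeness property. -/
def HausClose {A G : Type*} [Group G] (π : FreeMonoid A →* G) (L : Language A) : Prop :=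
  ∃ N : ℕ, ∀ u ∈ L, ∀ v ∈ L, wdist π (evalW π u) (evalW π v) ≤ 1 →
    HausdorffLE π N (Set.range fun n : ℕ => evalW π (u.take n))
      (Set.range fun n : ℕ => evalW π (v.take n))

/-- The padded alphabet `C = (A×B) ∪ (A×{$}) ∪ ({$}×B)` of convolution. -/
abbrev ConvAlphabet (A B : Type*) := (A × B) ⊕ (A ⊕ B)

/-- The convolution `u ⋄ v` of two words. -/
def conv {A B : Type*} : List A → List B → List (ConvAlphabet A B)
  | [], [] => []
  | [], b :: v => Sum.inr (Sum.inr b) :: conv [] v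
  | a :: u, [] => Sum.inr (Sum.inl a) :: conv u []
  | a :: u, b :: v => Sum.inl (a, b) :: conv u v
  termination_by u v => u.length + v.length

/-- The convolution `L₁ ⋄ L₂` of two languages. -/
def convLang {A B : Type*} (L₁ : Language A) (L₂ : Language B) :
    Language (ConvAlphabet A B) :=
  {w : List (ConvAlphabet A B) | ∃ u ∈ L₁, ∃ v ∈ L₂, w = conv u v}

/-- The natural homomorphism `C* → G × G'` for the convolution alphabet. -/
def convHom {A B G G' : Type*} [Group G] [Group G'] (π₁ : FreeMonoid A →* G)
    (π₂ : FreeMonoid B →* G') : FreeMonoid (ConvAlphabet A B) →* G × G' :=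
  FreeMonoid.lift fun c =>
    match c with
    | Sum.inl (a, b) => (π₁ (FreeMonoid.of a), π₂ (FreeMonoid.of b))
    | Sum.inr (Sum.inl a) => (π₁ (FreeMonoid.of a), 1)
    | Sum.inr (Sum.inr b) => (1, π₂ (FreeMonoid.of b))

/-- A group is automatic if it admits an automatic structure over some finite alphabet. -/
def IsAutomaticGroup (G : Type*) [Group G] : Prop :=
  ∃ (A : Type) (_ : Fintype A) (π : FreeMonoid A →* G) (L : Language A),
    IsAutomaticStructure π L

end Auto

namespace Auto

section Metric
variable {A B G : Type*} [Group G]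

lemma gens_inv (π : FreeMonoid A →* G) {x : G} (hx : x ∈ gens π) : x⁻¹ ∈ gens π := by
  rcases hx with ⟨a, rfl⟩ | ⟨a, rfl⟩
  · exact Or.inr ⟨a, rfl⟩
  · exact Or.inl ⟨a, by simp⟩

lemma evalW_append (π : FreeMonoid A →* G) (u v : List A) :
    evalW π (u ++ v) = evalW π u * evalW π v := by
  simp [evalW, FreeMonoid.ofList_append]

lemma evalW_nil (π : FreeMonoid A →* G) : evalW π [] = 1 := by
  simp [evalW]

lemma evalW_cons (π : FreeMonoid A →* G) (a : A) (v : List A) :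
    evalW π (a :: v) = π (FreeMonoid.of a) * evalW π v := by
  simp [evalW, FreeMonoid.ofList_cons]

lemma evalW_prod (π : FreeMonoid A →* G) (z : List A) :
    (z.map fun a => π (FreeMonoid.of a)).prod = evalW π z := by
  induction z with
  | nil => simp [evalW_nil]
  | cons a z ih => simp [evalW_cons, ih]

lemma wdist_le_of (π : FreeMonoid A →* G) {g h : G} {k : ℕ}
    (H : ∃ l : List G, l.length ≤ k ∧ (∀ x ∈ l, x ∈ gens π) ∧ l.prod = g⁻¹ * h) :
    wdist π g h ≤ k := by
  obtain ⟨l, hl, h1, h2⟩ := H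
  refine le_trans ?_ hl
  exact Nat.sInf_le ⟨l, rfl, h1, h2⟩

lemma wdist_le_iff (π : FreeMonoid A →* G) (hπ : Function.Surjective π) {g h : G} {k : ℕ} :
    wdist π g h ≤ k ↔
      ∃ l : List G, l.length ≤ k ∧ (∀ x ∈ l, x ∈ gens π) ∧ l.prod = g⁻¹ * h := by
  refine ⟨fun H => ?_, wdist_le_of π⟩
  have hne : {n : ℕ | ∃ l : List G, l.length = n ∧ (∀ x ∈ l, x ∈ gens π) ∧
      l.prod = g⁻¹ * h}.Nonempty := by
    obtain ⟨w, hw⟩ := hπ (g⁻¹ * h)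
    refine ⟨_, w.toList.map (fun a => π (FreeMonoid.of a)), rfl, ?_, ?_⟩
    · intro x hx
      obtain ⟨a, -, rfl⟩ := List.mem_map.1 hx
      exact Or.inl ⟨a, rfl⟩
    · rw [evalW_prod]; simpa [evalW] using hw
  obtain ⟨l, hl, h1, h2⟩ := Nat.sInf_mem hne
  exact ⟨l, hl.le.trans H, h1, h2⟩

lemma wdist_self (π : FreeMonoid A →* G) (g : G) : wdist π g g = 0 :=
  Nat.le_zero.1 (wdist_le_of π ⟨[], by simp, by simp, by simp⟩)

lemma wdist_append (π : FreeMonoid A →* G) (u z : List A) :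
    wdist π (evalW π u) (evalW π (u ++ z)) ≤ z.length := by
  refine wdist_le_of π ⟨z.map (fun a => π (FreeMonoid.of a)), by simp, ?_, ?_⟩
  · intro x hx
    obtain ⟨a, -, rfl⟩ := List.mem_map.1 hx
    exact Or.inl ⟨a, rfl⟩
  · rw [evalW_prod, evalW_append]; simp

lemma wdist_mul_left (π : FreeMonoid A →* G) (x g h : G) :
    wdist π (x * g) (x * h) = wdist π g h := by
  have : (x * g)⁻¹ * (x * h) = g⁻¹ * h := by group
  unfold wdist
  rw [this]

lemma wdist_comm_le (π : FreeMonoid A →* G) (hπ : Function.Surjective π) (g h : G) :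
    wdist π g h ≤ wdist π h g := by
  obtain ⟨l, hl, h1, h2⟩ := (wdist_le_iff π hπ).1 (le_refl (wdist π h g))
  refine wdist_le_of π ⟨(l.map fun x => x⁻¹).reverse, by simpa using hl, ?_, ?_⟩
  · intro x hx
    simp only [List.mem_reverse, List.mem_map] at hx
    obtain ⟨y, hy, rfl⟩ := hx
    exact gens_inv π (h1 y hy)
  · rw [← List.prod_inv_reverse, h2]; group

lemma wdist_comm (π : FreeMonoid A →* G) (hπ : Function.Surjective π) (g h : G) :
    wdist π g h = wdist π h g :=
  le_antisymm (wdist_comm_le π hπ g h) (wdist_comm_le π hπ h g)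

lemma wdist_tri (π : FreeMonoid A →* G) (hπ : Function.Surjective π) (g h k : G) :
    wdist π g k ≤ wdist π g h + wdist π h k := by
  obtain ⟨l, hl, h1, h2⟩ := (wdist_le_iff π hπ).1 (le_refl (wdist π g h))
  obtain ⟨l', hl', h1', h2'⟩ := (wdist_le_iff π hπ).1 (le_refl (wdist π h k))
  refine wdist_le_of π ⟨l ++ l', by simp; omega, ?_, by rw [List.prod_append, h2, h2']; group⟩
  intro x hx
  rcases List.mem_append.1 hx with hx | hx
  exacts [h1 x hx, h1' x hx]

lemma wdist_split (π : FreeMonoid A →* G) (hπ : Function.Surjective π) {g h : G} {k : ℕ}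
    (H : wdist π g h ≤ k + 1) : ∃ m, wdist π g m ≤ 1 ∧ wdist π m h ≤ k := by
  obtain ⟨l, hl, h1, h2⟩ := (wdist_le_iff π hπ).1 H
  cases l with
  | nil =>
    have : g = h := by
      simp only [List.prod_nil] at h2
      exact (inv_mul_eq_one.1 h2.symm)
    subst this
    exact ⟨g, by simp [wdist_self], by simp [wdist_self]⟩
  | cons x l =>
    refine ⟨g * x, wdist_le_of π ⟨[x], by simp, ?_, by simp⟩, wdist_le_of π ⟨l, ?_, ?_, ?_⟩⟩
    · intro y hy; rw [List.mem_singleton] at hy; subst hy; exact h1 _ (by simp)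
    · simpa using hl
    · intro y hy; exact h1 y (by simp [hy])
    · rw [List.prod_cons] at h2
      rw [mul_inv_rev, mul_assoc, ← h2]; group

/-- Word metrics are comparable. -/
lemma wdist_lip [Fintype A] (π : FreeMonoid A →* G) (hπ : Function.Surjective π)
    (π' : FreeMonoid B →* G) (hπ' : Function.Surjective π') :
    ∃ C : ℕ, ∀ (k : ℕ) (g h : G), wdist π g h ≤ k → wdist π' g h ≤ k * C := by
  refine ⟨∑ a : A, wdist π' 1 (π (FreeMonoid.of a)), ?_⟩
  set C := ∑ a : A, wdist π' 1 (π (FreeMonoid.of a)) with hC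
  have hgen : ∀ x ∈ gens π, ∀ g, wdist π' g (g * x) ≤ C := by
    intro x hx g
    have e : wdist π' g (g * x) = wdist π' 1 x := by
      have := wdist_mul_left π' g 1 x
      rwa [mul_one] at this
    rw [e]
    rcases hx with ⟨a, rfl⟩ | ⟨a, rfl⟩
    · exact Finset.single_le_sum (f := fun a : A => wdist π' 1 (π (FreeMonoid.of a)))
        (fun _ _ => Nat.zero_le _) (Finset.mem_univ a)
    · have := wdist_mul_left π' (π (FreeMonoid.of a)) 1 (π (FreeMonoid.of a))⁻¹
      rw [mul_inv_cancel, mul_one] at this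
      show wdist π' 1 (π (FreeMonoid.of a))⁻¹ ≤ C
      rw [← this, wdist_comm π' hπ']
      exact Finset.single_le_sum (f := fun a : A => wdist π' 1 (π (FreeMonoid.of a)))
        (fun _ _ => Nat.zero_le _) (Finset.mem_univ a)
  have key : ∀ (l : List G), (∀ x ∈ l, x ∈ gens π) → ∀ g,
      wdist π' g (g * l.prod) ≤ l.length * C := by
    intro l
    induction l with
    | nil => intro _ g; simp [wdist_self]
    | cons x l ih =>
      intro hl g
      have a1 := hgen x (hl x (by simp)) g
      have a2 := ih (fun y hy => hl y (by simp [hy])) (g * x)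
      have a3 := wdist_tri π' hπ' g (g * x) (g * x * l.prod)
      rw [List.prod_cons, ← mul_assoc, List.length_cons, Nat.succ_mul]
      omega
  intro k g h H
  obtain ⟨l, hl, h1, h2⟩ := (wdist_le_iff π hπ).1 H
  have := key l h1 g
  rw [h2, mul_inv_cancel_left] at this
  exact this.trans (Nat.mul_le_mul_right _ hl)

end Metric

section Lang
variable {A B G : Type*} [Group G]

lemma sync_iter {π : FreeMonoid A →* G} (hπ : Function.Surjective π) {L : Language A}
    (h : IsAutomaticStructure π L) (k : ℕ) :
    ∃ N : ℕ, ∀ u ∈ L, ∀ v ∈ L, wdist π (evalW π u) (evalW π v) ≤ k →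
      ∀ n, wdist π (evalW π (u.take n)) (evalW π (v.take n)) ≤ N := by
  obtain ⟨N, hN⟩ := h.ft
  have hN' : ∀ u ∈ L, ∀ v ∈ L, wdist π (evalW π u) (evalW π v) ≤ 1 →
      ∀ n, wdist π (evalW π (u.take n)) (evalW π (v.take n)) ≤ N := by
    intro u hu v hv huv n
    have := hN u hu v hv huv n
    exact_mod_cast this
  induction k with
  | zero => exact ⟨N, fun u hu v hv huv => hN' u hu v hv (by omega)⟩
  | succ k ih =>
    obtain ⟨K, hK⟩ := ih
    refine ⟨N + K, fun u hu v hv huv n => ?_⟩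
    obtain ⟨m, hm1, hm2⟩ := wdist_split π hπ huv
    obtain ⟨w, hw, rfl⟩ := h.onto m
    have a1 := hN' u hu w hw hm1 n
    have a2 := hK w hw v hv hm2 n
    have := wdist_tri π hπ (evalW π (u.take n)) (evalW π (w.take n)) (evalW π (v.take n))
    omega

lemma extend {L : Language A} (h : IsRegular L) :
    ∃ S : ℕ, ∀ w ∈ L, ∀ n : ℕ, ∃ w' ∈ L, (∀ j ≤ n, w'.take j = w.take j) ∧
      (∃ z : List A, z.length ≤ S ∧ w' = w.take n ++ z) ∧
      ∀ j, n ≤ j → ∃ z : List A, z.length ≤ S ∧ w'.take j = w.take n ++ z := by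
  classical
  obtain ⟨σ, _, M, rfl⟩ := h
  have hz : ∀ s : σ, ∃ z : List A, (∃ z', M.evalFrom s z' ∈ M.accept) →
      M.evalFrom s z ∈ M.accept := by
    intro s
    by_cases hs : ∃ z', M.evalFrom s z' ∈ M.accept
    · obtain ⟨z, hz⟩ := hs
      exact ⟨z, fun _ => hz⟩
    · exact ⟨[], fun h => absurd h hs⟩
  choose z hz using hz
  refine ⟨∑ s, (z s).length, fun w hw n => ?_⟩
  rcases le_total w.length n with hn | hn
  · refine ⟨w, hw, fun _ _ => rfl, ⟨[], by simp, by simp [List.take_of_length_le hn]⟩, ?_⟩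
    intro j hj
    exact ⟨[], by simp, by simp [List.take_of_length_le hn, List.take_of_length_le (hn.trans hj)]⟩
  · set s := M.eval (w.take n) with hs
    have hlen : (z s).length ≤ ∑ s, (z s).length :=
      Finset.single_le_sum (f := fun s => (z s).length)
        (fun _ _ => Nat.zero_le _) (Finset.mem_univ s)
    refine ⟨w.take n ++ z s, ?_, ?_, ⟨z s, hlen, rfl⟩, ?_⟩
    · have : M.evalFrom s (z s) ∈ M.accept := by
        refine hz s ⟨w.drop n, ?_⟩
        have hw' : M.eval w ∈ M.accept := hw
        rw [← List.take_append_drop n w] at hw'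
        rwa [DFA.eval, DFA.evalFrom_of_append] at hw'
      show M.eval _ ∈ M.accept
      rwa [DFA.eval, DFA.evalFrom_of_append]
    · intro j hj
      rw [List.take_append_of_le_length (by simp; omega), List.take_take, min_eq_left hj]
    · intro j hj
      refine ⟨(z s).take (j - n), by simp; omega, ?_⟩
      rw [List.take_append, List.take_of_length_le (by simp; omega)]
      simp [min_eq_left hn]

/-- A word of an automatic structure does not make long excursions. -/
lemma no_backtrack {π : FreeMonoid A →* G} (hπ : Function.Surjective π) {L : Language A}
    (h : IsAutomaticStructure π L) (r : ℕ) :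
    ∃ R : ℕ, ∀ v ∈ L, ∀ s j t : ℕ, s ≤ j → j ≤ t →
      wdist π (evalW π (v.take s)) (evalW π (v.take t)) ≤ r →
      wdist π (evalW π (v.take s)) (evalW π (v.take j)) ≤ R := by
  obtain ⟨S, hS⟩ := extend h.regular
  obtain ⟨N, hN⟩ := sync_iter hπ h (S + r + S)
  refine ⟨S + N, fun v hv s j t hsj hjt hst => ?_⟩
  obtain ⟨v1, hv1, -, ⟨z1, hz1, e1⟩, b1⟩ := hS v hv s
  obtain ⟨v2, hv2, a2, ⟨z2, hz2, e2⟩, -⟩ := hS v hv t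
  obtain ⟨z3, hz3, e3⟩ := b1 j hsj
  have d1 := wdist_append π (v.take s) z1
  have d2 := wdist_append π (v.take t) z2
  have d3 := wdist_append π (v.take s) z3
  rw [← e1, wdist_comm π hπ] at d1
  rw [← e2] at d2
  rw [← e3] at d3
  have t1 := wdist_tri π hπ (evalW π v1) (evalW π (v.take s)) (evalW π v2)
  have t2 := wdist_tri π hπ (evalW π (v.take s)) (evalW π (v.take t)) (evalW π v2)
  have d4 := hN v1 hv1 v2 hv2 (by omega) j
  rw [a2 j hjt] at d4
  have t3 := wdist_tri π hπ (evalW π (v.take s)) (evalW π (v1.take j)) (evalW π (v.take j))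
  omega

lemma path_lemma (M : ℕ → ℕ) (hM : Monotone M) (h0 : M 0 = 0) (hinf : ∀ b, ∃ n, b ≤ M n)
    (P : ℕ → ℕ → Prop) (hP : ∀ n j, M n ≤ j → j ≤ M (n + 1) → P n j) :
    ∃ φ ψ : ℕ → ℕ, Monotone φ ∧ Monotone ψ ∧
        Function.Surjective φ ∧ Function.Surjective ψ ∧ ∀ t, P (φ t) (ψ t) := by
  let step : ℕ × ℕ → ℕ × ℕ := fun p => if p.2 < M (p.1 + 1) then (p.1, p.2 + 1) else (p.1 + 1, p.2)
  let f : ℕ → ℕ × ℕ := fun t => step^[t] (0, 0)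
  have fs : ∀ t, f (t + 1) = step (f t) := fun t => Function.iterate_succ_apply' _ _ _
  have f0 : f 0 = (0, 0) := rfl
  have inv : ∀ t, M (f t).1 ≤ (f t).2 ∧ (f t).2 ≤ M ((f t).1 + 1) ∧ (f t).1 + (f t).2 = t := by
    intro t
    induction t with
    | zero => simp [f0, h0]
    | succ t ih =>
      obtain ⟨i1, i2, i3⟩ := ih
      rw [fs]
      by_cases hc : (f t).2 < M ((f t).1 + 1)
      · simp only [step, if_pos hc]
        omega
      · simp only [step, if_neg hc]
        have := hM (Nat.le_succ ((f t).1 + 1))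
        simp only [Nat.succ_eq_add_one] at this
        omega
  have st : ∀ t, ((f (t+1)).1 = (f t).1 ∨ (f (t+1)).1 = (f t).1 + 1) ∧
      ((f (t+1)).2 = (f t).2 ∨ (f (t+1)).2 = (f t).2 + 1) := by
    intro t
    rw [fs]
    by_cases hc : (f t).2 < M ((f t).1 + 1)
    · simp [step, if_pos hc]
    · simp [step, if_neg hc]
  have surj : ∀ g : ℕ → ℕ, g 0 = 0 → (∀ t, g (t+1) = g t ∨ g (t+1) = g t + 1) →
      (∀ b, ∃ t, b ≤ g t) → Function.Surjective g := by
    intro g g0 gs gu b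
    classical
    have hb := gu b
    have h1 := Nat.find_spec hb
    have h2 := fun m => Nat.find_min hb (m := m)
    refine ⟨Nat.find hb, ?_⟩
    generalize Nat.find hb = t at *
    cases t with
    | zero => omega
    | succ t =>
      have := h2 t (by omega)
      rcases gs t with h | h <;> omega
  refine ⟨fun t => (f t).1, fun t => (f t).2, monotone_nat_of_le_succ fun t => ?_,
    monotone_nat_of_le_succ fun t => ?_, surj _ rfl (fun t => (st t).1) ?_,
    surj _ rfl (fun t => (st t).2) ?_, fun t => hP _ _ (inv t).1 (inv t).2.1⟩
  · rcases (st t).1 with h | h <;> omega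
  · rcases (st t).2 with h | h <;> omega
  · intro b
    refine ⟨b + M (b + 1), ?_⟩
    by_contra hlt
    have i := inv (b + M (b + 1))
    have : M ((f (b + M (b + 1))).1 + 1) ≤ M (b + 1) := hM (by omega)
    omega
  · intro b
    obtain ⟨n, hn⟩ := hinf b
    refine ⟨n + b, ?_⟩
    have i := inv (n + b)
    by_contra hlt
    have : M n ≤ M (f (n + b)).1 := hM (by omega)
    omega

lemma union_regular {L₁ : Language A} {L₂ : Language B} (h₁ : IsRegular L₁) (h₂ : IsRegular L₂) :
    IsRegular (unionLang L₁ L₂) := by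
  obtain ⟨σ, _, M, rfl⟩ := h₁
  obtain ⟨τ, _, N, rfl⟩ := h₂
  let K : DFA (A ⊕ B) (Option σ × Option τ) :=
    { step := fun p c => match c with
        | Sum.inl a => (p.1.map fun s => M.step s a, none)
        | Sum.inr b => (none, p.2.map fun s => N.step s b)
      start := (some M.start, some N.start)
      accept := {p | (∃ s ∈ M.accept, p.1 = some s) ∨ ∃ s ∈ N.accept, p.2 = some s} }
  have k1 : ∀ w s, (K.eval w).1 = some s ↔ ∃ u, w = u.map Sum.inl ∧ M.eval u = s := by
    intro w
    induction w using List.reverseRecOn with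
    | nil =>
      intro s
      simp [K, DFA.eval, DFA.evalFrom]
    | append_singleton w c ih =>
      intro s
      rw [DFA.eval_append_singleton]
      cases c with
      | inl a =>
        simp only [K] at ih ⊢
        simp only [Option.map_eq_some_iff]
        constructor
        · rintro ⟨s', hs', rfl⟩
          obtain ⟨u, rfl, rfl⟩ := (ih s').1 hs'
          exact ⟨u ++ [a], by simp, by simp⟩
        · rintro ⟨u, hu, rfl⟩
          rcases List.eq_nil_or_concat' u with rfl | ⟨u, x, rfl⟩
          · simp at hu
          · simp only [List.map_append, List.map_cons, List.map_nil] at hu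
            obtain ⟨rfl, hx⟩ := List.append_inj' hu rfl
            simp at hx
            subst hx
            exact ⟨_, (ih _).2 ⟨u, rfl, rfl⟩, by simp⟩
      | inr b =>
        simp only [K]
        constructor
        · intro h; simp at h
        · rintro ⟨u, hu, -⟩
          have : (Sum.inr b : A ⊕ B) ∈ u.map Sum.inl := by rw [← hu]; simp
          simp at this
  have k2 : ∀ w s, (K.eval w).2 = some s ↔ ∃ u, w = u.map Sum.inr ∧ N.eval u = s := by
    intro w
    induction w using List.reverseRecOn with
    | nil =>
      intro s
      simp [K, DFA.eval, DFA.evalFrom]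
    | append_singleton w c ih =>
      intro s
      rw [DFA.eval_append_singleton]
      cases c with
      | inr a =>
        simp only [K] at ih ⊢
        simp only [Option.map_eq_some_iff]
        constructor
        · rintro ⟨s', hs', rfl⟩
          obtain ⟨u, rfl, rfl⟩ := (ih s').1 hs'
          exact ⟨u ++ [a], by simp, by simp⟩
        · rintro ⟨u, hu, rfl⟩
          rcases List.eq_nil_or_concat' u with rfl | ⟨u, x, rfl⟩
          · simp at hu
          · simp only [List.map_append, List.map_cons, List.map_nil] at hu
            obtain ⟨rfl, hx⟩ := List.append_inj' hu rfl
            simp at hx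
            subst hx
            exact ⟨_, (ih _).2 ⟨u, rfl, rfl⟩, by simp⟩
      | inl b =>
        simp only [K]
        constructor
        · intro h; simp at h
        · rintro ⟨u, hu, -⟩
          have : (Sum.inl b : A ⊕ B) ∈ u.map Sum.inr := by rw [← hu]; simp
          simp at this
  refine ⟨_, inferInstance, K, ?_⟩
  ext w
  show ((∃ s ∈ M.accept, (K.eval w).1 = some s) ∨ ∃ s ∈ N.accept, (K.eval w).2 = some s) ↔
    ((∃ u ∈ M.accepts, w = u.map Sum.inl) ∨ ∃ v ∈ N.accepts, w = v.map Sum.inr)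
  simp only [k1, k2]
  refine or_congr ⟨?_, ?_⟩ ⟨?_, ?_⟩
  · rintro ⟨s, hs, u, rfl, rfl⟩; exact ⟨u, hs, rfl⟩
  · rintro ⟨u, hu, rfl⟩; exact ⟨_, hu, u, rfl, rfl⟩
  · rintro ⟨s, hs, u, rfl, rfl⟩; exact ⟨u, hs, rfl⟩
  · rintro ⟨u, hu, rfl⟩; exact ⟨_, hu, u, rfl, rfl⟩

lemma evalW_inl (π₁ : FreeMonoid A →* G) (π₂ : FreeMonoid B →* G) (u : List A) :
    evalW (sumHom π₁ π₂) (u.map Sum.inl) = evalW π₁ u := by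
  induction u with
  | nil => simp [evalW_nil]
  | cons a u ih => rw [List.map_cons, evalW_cons, evalW_cons, ih]; simp [sumHom]

lemma evalW_inr (π₁ : FreeMonoid A →* G) (π₂ : FreeMonoid B →* G) (u : List B) :
    evalW (sumHom π₁ π₂) (u.map Sum.inr) = evalW π₂ u := by
  induction u with
  | nil => simp [evalW_nil]
  | cons a u ih => rw [List.map_cons, evalW_cons, evalW_cons, ih]; simp [sumHom]

lemma sumHom_surj (π₁ : FreeMonoid A →* G) (hπ₁ : Function.Surjective π₁)
    (π₂ : FreeMonoid B →* G) : Function.Surjective (sumHom π₁ π₂) := by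
  intro g
  obtain ⟨w, rfl⟩ := hπ₁ g
  exact ⟨_, evalW_inl π₁ π₂ w.toList⟩

/-- The main step: one-sided Hausdorff closeness gives asynchronous fellow travelling. -/
lemma async_of_brp [Fintype A] {π₁ : FreeMonoid A →* G} (hπ₁ : Function.Surjective π₁)
    {π₂ : FreeMonoid B →* G} (hπ₂ : Function.Surjective π₂)
    {L₁ : Language A} {L₂ : Language B}
    (h₁ : IsAutomaticStructure π₁ L₁) (h₂ : IsAutomaticStructure π₂ L₂)
    (h : BRP π₁ π₂ (MonoidHom.id G) L₁ L₂) (k : ℕ) :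
    ∃ p : ℕ, ∀ u ∈ L₁, ∀ v ∈ L₂, wdist π₂ (evalW π₁ u) (evalW π₂ v) ≤ k →
      ∃ φ ψ : ℕ → ℕ, Monotone φ ∧ Monotone ψ ∧
        Function.Surjective φ ∧ Function.Surjective ψ ∧
          ∀ t : ℕ, wdist π₂ (evalW π₁ (u.take (φ t))) (evalW π₂ (v.take (ψ t))) ≤ p := by
  have tri := wdist_tri π₂ hπ₂
  have symm := wdist_comm π₂ hπ₂
  have close : ∀ k : ℕ, ∃ N : ℕ, ∀ u ∈ L₁, ∀ v ∈ L₂,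
      wdist π₂ (evalW π₁ u) (evalW π₂ v) ≤ k →
      ∀ n, ∃ m, wdist π₂ (evalW π₁ (u.take n)) (evalW π₂ (v.take m)) ≤ N := by
    intro k
    obtain ⟨N, hN⟩ := h
    obtain ⟨N', hN'⟩ := sync_iter hπ₂ h₂ k
    refine ⟨N + N', fun u hu v hv huv n => ?_⟩
    obtain ⟨β, hβ, e⟩ := h₂.onto (evalW π₁ u)
    have := (hN 1 u hu β hβ (by simpa using e)).1
    obtain ⟨_, ⟨m, rfl⟩, hm⟩ := this _ ⟨n, rfl⟩
    simp only [MonoidHom.id_apply, one_mul] at hm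
    refine ⟨m, ?_⟩
    have d := hN' β hβ v hv (by rwa [e]) m
    have := tri (evalW π₁ (u.take n)) (evalW π₂ (β.take m)) (evalW π₂ (v.take m))
    omega
  obtain ⟨C, hC⟩ := wdist_lip π₁ hπ₁ π₂ hπ₂
  have pref : ∀ k : ℕ, ∃ N : ℕ, ∀ u ∈ L₁, ∀ v ∈ L₂, ∀ n m : ℕ,
      wdist π₂ (evalW π₁ (u.take n)) (evalW π₂ (v.take m)) ≤ k →
      ∀ i ≤ n, ∃ j ≤ m, wdist π₂ (evalW π₁ (u.take i)) (evalW π₂ (v.take j)) ≤ N := by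
    intro k
    obtain ⟨S, hS⟩ := extend h₁.regular
    obtain ⟨T, hT⟩ := extend h₂.regular
    obtain ⟨N, hN⟩ := close (S * C + k + T)
    refine ⟨N + T, fun u hu v hv n m huv i hi => ?_⟩
    obtain ⟨u', hu', a1, ⟨z1, hz1, e1⟩, -⟩ := hS u hu n
    obtain ⟨v', hv', a2, ⟨z2, hz2, e2⟩, b2⟩ := hT v hv m
    have d1 := wdist_append π₁ (u.take n) z1
    rw [← e1] at d1
    have d1' := hC S _ _ (d1.trans hz1)
    rw [symm] at d1'
    have d2 := wdist_append π₂ (v.take m) z2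
    rw [← e2] at d2
    have t1 := tri (evalW π₁ u') (evalW π₁ (u.take n)) (evalW π₂ v')
    have t2 := tri (evalW π₁ (u.take n)) (evalW π₂ (v.take m)) (evalW π₂ v')
    obtain ⟨j, hj⟩ := hN u' hu' v' hv' (by omega) i
    rw [a1 i hi] at hj
    rcases le_total j m with hjm | hjm
    · rw [a2 j hjm] at hj
      exact ⟨j, hjm, by omega⟩
    · obtain ⟨z3, hz3, e3⟩ := b2 j hjm
      have d3 := wdist_append π₂ (v.take m) z3
      rw [← e3, symm] at d3
      have := tri (evalW π₁ (u.take i)) (evalW π₂ (v'.take j)) (evalW π₂ (v.take m))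
      exact ⟨m, le_rfl, by omega⟩
  obtain ⟨N, hN⟩ := close k
  obtain ⟨N', hN'⟩ := pref (N + k)
  obtain ⟨R, hR⟩ := no_backtrack hπ₂ h₂ (N' + (N + k))
  obtain ⟨K, hK⟩ : ∃ K, K = (N + k) + (N' + (N + k)) + R := ⟨_, rfl⟩
  obtain ⟨R', hR'⟩ := no_backtrack hπ₂ h₂ (K + C + K)
  refine ⟨K + R', fun u hu v hv huv => ?_⟩
  choose m0 hm0 using hN u hu v hv huv
  let m : ℕ → ℕ := fun n => if n = 0 then 0 else if n < u.length then m0 n else v.length + n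
  have hm : ∀ n, wdist π₂ (evalW π₁ (u.take n)) (evalW π₂ (v.take (m n))) ≤ N + k := by
    intro n
    by_cases h0 : n = 0
    · simp [m, h0, evalW_nil, wdist_self]
    · by_cases h1 : n < u.length
      · simp only [m, if_neg h0, if_pos h1]
        have := hm0 n
        omega
      · simp only [m, if_neg h0, if_neg h1]
        rw [List.take_of_length_le (by omega), List.take_of_length_le (by omega)]
        omega
  let M : ℕ → ℕ := fun n => partialSups m n
  have hMm : ∀ n, ∃ i ≤ n, M n = m i := by
    intro n
    obtain ⟨i, hi, e⟩ := exists_partialSups_eq m n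
    exact ⟨i, hi, e⟩
  have hM : ∀ n, wdist π₂ (evalW π₁ (u.take n)) (evalW π₂ (v.take (M n))) ≤ K := by
    intro n
    obtain ⟨i, hi, e⟩ := hMm n
    have hle : m n ≤ m i := by rw [← e]; exact le_partialSups m n
    obtain ⟨j, hj, dj⟩ := hN' u hu v hv n (m n) (hm n) i hi
    rw [e]
    have t1 := tri (evalW π₂ (v.take j)) (evalW π₁ (u.take i)) (evalW π₂ (v.take (m i)))
    have t2 := hm i
    rw [symm] at dj
    have t3 := hR v hv j (m n) (m i) hj hle (by omega)
    rw [symm] at t3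
    have t4 := tri (evalW π₁ (u.take n)) (evalW π₂ (v.take (m n))) (evalW π₂ (v.take (m i)))
    have t5 := tri (evalW π₂ (v.take (m n))) (evalW π₂ (v.take j)) (evalW π₂ (v.take (m i)))
    have t6 := hm n
    omega
  have hMmono : Monotone M := (partialSups m).monotone
  have hMgap : ∀ n j, M n ≤ j → j ≤ M (n + 1) →
      wdist π₂ (evalW π₁ (u.take n)) (evalW π₂ (v.take j)) ≤ K + R' := by
    intro n j h1 h2
    have d1 := hM n
    have d2 := hM (n + 1)
    have d3 : wdist π₂ (evalW π₁ (u.take n)) (evalW π₁ (u.take (n + 1))) ≤ C := by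
      have e : u.take (n + 1) = u.take n ++ (u.drop n).take 1 := by
        rw [List.take_add]
      have := wdist_append π₁ (u.take n) ((u.drop n).take 1)
      rw [← e] at this
      have := hC 1 _ _ (this.trans (by simp))
      omega
    have s1 := symm (evalW π₂ (v.take (M n))) (evalW π₁ (u.take n))
    have t1 := tri (evalW π₂ (v.take (M n))) (evalW π₁ (u.take n)) (evalW π₁ (u.take (n+1)))
    have t2 := tri (evalW π₂ (v.take (M n))) (evalW π₁ (u.take (n+1)))
      (evalW π₂ (v.take (M (n+1))))
    have t3 := hR' v hv (M n) j (M (n+1)) h1 h2 (by omega)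
    have t4 := tri (evalW π₁ (u.take n)) (evalW π₂ (v.take (M n))) (evalW π₂ (v.take j))
    omega
  refine path_lemma M hMmono ?_ ?_
    (fun n j => wdist π₂ (evalW π₁ (u.take n)) (evalW π₂ (v.take j)) ≤ K + R') hMgap
  · simp [M, m]
  · intro b
    refine ⟨b + u.length + 1, ?_⟩
    have h1 : m (b + u.length + 1) ≤ M (b + u.length + 1) := le_partialSups m _
    have h2 : m (b + u.length + 1) = v.length + (b + u.length + 1) := by
      simp only [m]
      rw [if_neg (by omega), if_neg (by omega)]
    omega

end Lang

end Auto

open Auto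

/-- `L₁` and `L₂` are equivalent iff the BRP holds for the identity
`(ι, L₁, L₂)`, and synchronously equivalent iff the synchronous BRP holds for
`(ι, L₁, L₂)`. -/
theorem equiv_iff_brp_id {A B G : Type*} [Fintype A] [Fintype B] [Group G]
    (π₁ : FreeMonoid A →* G) (hπ₁ : Function.Surjective π₁)
    (π₂ : FreeMonoid B →* G) (hπ₂ : Function.Surjective π₂)
    (L₁ : Language A) (L₂ : Language B)
    (h₁ : IsAutomaticStructure π₁ L₁) (h₂ : IsAutomaticStructure π₂ L₂) :
    (LangEquivalent π₁ π₂ L₁ L₂ ↔ BRP π₁ π₂ (MonoidHom.id G) L₁ L₂) ∧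
      (LangSyncEquivalent π₁ π₂ L₁ L₂ ↔ SyncBRP π₁ π₂ (MonoidHom.id G) L₁ L₂) := by
  have hπ₃ := sumHom_surj π₁ hπ₁ π₂
  have symm₃ := wdist_comm (sumHom π₁ π₂) hπ₃
  obtain ⟨C, hC⟩ := wdist_lip (sumHom π₁ π₂) hπ₃ π₂ hπ₂
  obtain ⟨C', hC'⟩ := wdist_lip (sumHom π₁ π₂) hπ₃ π₁ hπ₁
  obtain ⟨D, hD⟩ := wdist_lip π₂ hπ₂ (sumHom π₁ π₂) hπ₃
  obtain ⟨D', hD'⟩ := wdist_lip π₁ hπ₁ (sumHom π₁ π₂) hπ₃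
  have hreg := union_regular h₁.regular h₂.regular
  have honto : ∀ g : G, ∃ w ∈ unionLang L₁ L₂, evalW (sumHom π₁ π₂) w = g := by
    intro g
    obtain ⟨w, hw, rfl⟩ := h₁.onto g
    exact ⟨_, Or.inl ⟨w, hw, rfl⟩, evalW_inl π₁ π₂ w⟩
  have tl : ∀ (u : List A) n, evalW (sumHom π₁ π₂) ((u.map Sum.inl).take n) =
      evalW π₁ (u.take n) := by
    intro u n; rw [← List.map_take, evalW_inl]
  have tr : ∀ (u : List B) n, evalW (sumHom π₁ π₂) ((u.map Sum.inr).take n) =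
      evalW π₂ (u.take n) := by
    intro u n; rw [← List.map_take, evalW_inr]
  obtain ⟨N₁, hN₁⟩ := sync_iter hπ₁ h₁ (1 * C')
  obtain ⟨N₂, hN₂⟩ := sync_iter hπ₂ h₂ (1 * C)
  refine ⟨⟨?_, ?_⟩, ⟨?_, ?_⟩⟩
  · rintro ⟨-, -, p, hp⟩
    refine ⟨p * C, fun x α hα β hβ e => ?_⟩
    simp only [MonoidHom.id_apply] at e
    obtain ⟨φ, ψ, -, -, sφ, sψ, H⟩ := hp _ (Or.inl ⟨α, hα, rfl⟩) _ (Or.inr ⟨β, hβ, rfl⟩)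
      (by rw [evalW_inl, evalW_inr, e, wdist_self]; omega)
    have H' : ∀ t, wdist π₂ (evalW π₁ (α.take (φ t))) (evalW π₂ (β.take (ψ t))) ≤ p * C := by
      intro t
      have := H t
      rw [tl, tr] at this
      exact hC _ _ _ this
    constructor
    · rintro _ ⟨n, rfl⟩
      obtain ⟨t, rfl⟩ := sφ n
      refine ⟨_, ⟨ψ t, rfl⟩, ?_⟩
      simp only [MonoidHom.id_apply, wdist_mul_left]
      exact H' t
    · rintro _ ⟨n, rfl⟩
      obtain ⟨t, rfl⟩ := sψ n
      refine ⟨_, ⟨φ t, rfl⟩, ?_⟩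
      simp only [MonoidHom.id_apply, wdist_mul_left]
      rw [wdist_comm π₂ hπ₂]
      exact H' t
  · intro h
    obtain ⟨p, hp⟩ := async_of_brp hπ₁ hπ₂ h₁ h₂ h (1 * C)
    refine ⟨hreg, honto, N₁ * D' + N₂ * D + p * D, ?_⟩
    rintro _ (⟨u, hu, rfl⟩ | ⟨u, hu, rfl⟩) _ (⟨v, hv, rfl⟩ | ⟨v, hv, rfl⟩) huv
    · rw [evalW_inl, evalW_inl] at huv
      refine ⟨id, id, monotone_id, monotone_id, Function.surjective_id,
        Function.surjective_id, fun t => ?_⟩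
      rw [tl, tl]
      have := hD' _ _ _ (hN₁ u hu v hv (hC' _ _ _ huv) t)
      simp only [id]
      omega
    · rw [evalW_inl, evalW_inr] at huv
      obtain ⟨φ, ψ, m1, m2, s1, s2, H⟩ := hp u hu v hv (hC _ _ _ huv)
      refine ⟨φ, ψ, m1, m2, s1, s2, fun t => ?_⟩
      rw [tl, tr]
      have := hD _ _ _ (H t)
      omega
    · rw [evalW_inl, evalW_inr, symm₃] at huv
      obtain ⟨φ, ψ, m1, m2, s1, s2, H⟩ := hp v hv u hu (hC _ _ _ huv)
      refine ⟨ψ, φ, m2, m1, s2, s1, fun t => ?_⟩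
      rw [tl, tr, symm₃]
      have := hD _ _ _ (H t)
      omega
    · rw [evalW_inr, evalW_inr] at huv
      refine ⟨id, id, monotone_id, monotone_id, Function.surjective_id,
        Function.surjective_id, fun t => ?_⟩
      rw [tr, tr]
      have := hD _ _ _ (hN₂ u hu v hv (hC _ _ _ huv) t)
      simp only [id]
      omega
  · rintro ⟨-, -, p, hp⟩
    refine ⟨p * C, fun x α hα β hβ e n => ?_⟩
    simp only [MonoidHom.id_apply] at e
    have H := hp _ (Or.inl ⟨α, hα, rfl⟩) _ (Or.inr ⟨β, hβ, rfl⟩)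
      (by rw [evalW_inl, evalW_inr, e, wdist_self]; omega) n
    rw [tl, tr] at H
    simp only [MonoidHom.id_apply, wdist_mul_left]
    exact hC _ _ _ (by exact_mod_cast H)
  · rintro ⟨p, hp⟩
    have cross : ∀ u ∈ L₁, ∀ v ∈ L₂,
        wdist (sumHom π₁ π₂) (evalW π₁ u) (evalW π₂ v) ≤ 1 → ∀ n,
        wdist (sumHom π₁ π₂) (evalW π₁ (u.take n)) (evalW π₂ (v.take n)) ≤ (p + N₂) * D := by
      intro u hu v hv huv n
      obtain ⟨β, hβ, e⟩ := h₂.onto (evalW π₁ u)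
      have a1 := hp 1 u hu β hβ (by simpa using e) n
      simp only [MonoidHom.id_apply, one_mul] at a1
      have a2 := hN₂ β hβ v hv (by rw [e]; exact hC _ _ _ huv) n
      have := wdist_tri π₂ hπ₂ (evalW π₁ (u.take n)) (evalW π₂ (β.take n)) (evalW π₂ (v.take n))
      exact hD _ _ _ (by omega)
    refine ⟨hreg, honto, N₁ * D' + N₂ * D + (p + N₂) * D, ?_⟩
    rintro _ (⟨u, hu, rfl⟩ | ⟨u, hu, rfl⟩) _ (⟨v, hv, rfl⟩ | ⟨v, hv, rfl⟩) huv n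
    · rw [evalW_inl, evalW_inl] at huv
      rw [tl, tl]
      have := hD' _ _ _ (hN₁ u hu v hv (hC' _ _ _ huv) n)
      exact Nat.cast_le.2 (by omega)
    · rw [evalW_inl, evalW_inr] at huv
      rw [tl, tr]
      have := cross u hu v hv huv n
      exact Nat.cast_le.2 (by omega)
    · rw [evalW_inl, evalW_inr, symm₃] at huv
      rw [tl, tr, symm₃]
      have := cross v hv u hu huv n
      exact Nat.cast_le.2 (by omega)
    · rw [evalW_inr, evalW_inr] at huv
      rw [tr, tr]
      have := hD _ _ _ (hN₂ u hu v hv (hC _ _ _ huv) n)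
      exact Nat.cast_le.2 (by omega)
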